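/- arXiv:1306.2137 — 2 statements merged into one kernel-verified Lean document; each statement's English description precedes it below -/
import Mathlib

section
/- (McMullen's decomposition) Let V be an n-dimensional real vector space and let Val denote the space of continuous, translation invariant, real-valued valuations on 𝒦(V). Then Val = ⊕_{k=0}^{n} Val_k: every φ ∈ Val can be written uniquely as φ = Σ_{k=0}^{n} φ_k with φ_k ∈ Val_k, i.e., φ_k continuous, translation invariant, and homogeneous of degree k (φ_k(tK) = t^k φ_k(K) for all t ≥ 0). -/
open scoped Pointwise
open MeasureTheory Module

noncomputable section

section CommonDefs

variable {V V' A : Type*}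
variable [NormedAddCommGroup V] [NormedSpace ℝ V]
variable [NormedAddCommGroup V'] [NormedSpace ℝ V']
variable [NormedAddCommGroup A] [NormedSpace ℝ A]

/-- The supremum of a (pairing) functional over a convex body; used to express the
support function `h(K, ξ) = sup_{x ∈ K} ⟨ξ, x⟩` for the various pairings `p = ⟨ξ, ·⟩`. -/
def hSupp (K : ConvexBody V) (p : V → ℝ) : ℝ := sSup (p '' (K : Set V))

/-- The translate `x + K` of a convex body. -/
def ConvexBody.translate (K : ConvexBody V) (x : V) : ConvexBody V :=
  ⟨(fun y => x + y) '' (K : Set V), K.convex.translate x,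
    K.isCompact.image (continuous_const.add continuous_id),
    K.nonempty.image _⟩

/-- The image of a convex body under a continuous linear map. -/
def ConvexBody.mapCLM (f : V →L[ℝ] V') (K : ConvexBody V) : ConvexBody V' :=
  ⟨f '' (K : Set V), K.convex.linear_image (f : V →ₗ[ℝ] V'),
    K.isCompact.image f.continuous, K.nonempty.image _⟩

/-- The reflection `-K` of a convex body about the origin. -/
def ConvexBody.neg (K : ConvexBody V) : ConvexBody V :=
  K.mapCLM (-(ContinuousLinearMap.id ℝ V))

/-- The union of two convex bodies (a convex body provided it is convex). -/
def ConvexBody.union (K L : ConvexBody V) (h : Convex ℝ ((K : Set V) ∪ (L : Set V))) :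
    ConvexBody V :=
  ⟨(K : Set V) ∪ (L : Set V), h, K.isCompact.union L.isCompact,
    K.nonempty.mono Set.subset_union_left⟩

/-- The intersection of two convex bodies (a convex body provided it is nonempty). -/
def ConvexBody.inter (K L : ConvexBody V) (h : ((K : Set V) ∩ (L : Set V)).Nonempty) :
    ConvexBody V :=
  ⟨(K : Set V) ∩ (L : Set V), K.convex.inter L.convex,
    K.isCompact.inter_right L.isClosed, h⟩

/-- A Minkowski valuation: `Z(K ∪ L) + Z(K ∩ L) = Z(K) + Z(L)` (Minkowski addition)
whenever `K, L, K ∪ L` are convex bodies. -/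
def IsMinkowskiValuation (Z : ConvexBody V → ConvexBody A) : Prop :=
  ∀ (K L : ConvexBody V) (hU : Convex ℝ ((K : Set V) ∪ (L : Set V)))
    (hI : ((K : Set V) ∩ (L : Set V)).Nonempty),
    Z (K.union L hU) + Z (K.inter L hI) = Z K + Z L

/-- A real-valued valuation: `φ(K ∪ L) + φ(K ∩ L) = φ(K) + φ(L)`
whenever `K, L, K ∪ L` are convex bodies. -/
def IsValuation (φ : ConvexBody V → ℝ) : Prop :=
  ∀ (K L : ConvexBody V) (hU : Convex ℝ ((K : Set V) ∪ (L : Set V)))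
    (hI : ((K : Set V) ∩ (L : Set V)).Nonempty),
    φ (K.union L hU) + φ (K.inter L hI) = φ K + φ L

/-- Translation invariance of a map defined on convex bodies. -/
def IsTranslationInvariant {α : Type*} (Z : ConvexBody V → α) : Prop :=
  ∀ (K : ConvexBody V) (x : V), Z (K.translate x) = Z K

/-- The mixed volume (w.r.t. the Lebesgue (Haar) measure `μ`) of an `n`-tuple of convex
bodies, given by the polarization formula
`V(K₁, …, Kₙ) = (1/n!) ∑_{S ⊆ {1,…,n}} (-1)^{n - |S|} vol(∑_{i ∈ S} K_i)`. -/
def mixedVol [MeasurableSpace V] (μ : Measure V) {n : ℕ} (K : Fin n → ConvexBody V) : ℝ :=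
  (n.factorial : ℝ)⁻¹ *
    ∑ S : Finset (Fin n), (-1 : ℝ) ^ (n - S.card) * (μ (∑ i ∈ S, (K i : Set V))).toReal

/-- The extension `V(K, …, K, f)` (with `n - 1` copies of `K`) of the mixed volume to
continuous positively `1`-homogeneous functions `f` on the dual space, defined via
Aleksandrov's variational formula: `V(K,…,K,f)` is `1/n` times the right derivative at
`t = 0` of the volume of the Wulff shape (aka Aleksandrov body) of `h_K + t f`.
For `f = h_L` the Wulff shape is `K + t L`, so this indeed extends `L ↦ V(K, …, K, L)`. -/
def mixedVolFn [MeasurableSpace V] (μ : Measure V) (K : ConvexBody V)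
    (f : (V →L[ℝ] ℝ) → ℝ) : ℝ :=
  (Module.finrank ℝ V : ℝ)⁻¹ *
    derivWithin (fun t : ℝ =>
        (μ {x : V | ∀ ξ : V →L[ℝ] ℝ, ξ x ≤ hSupp K ξ + t * f ξ}).toReal)
      (Set.Ici 0) 0

/-- The dimension of a convex body: the dimension of (the direction of) its affine hull. -/
def bodyDim (K : ConvexBody V) : ℕ := Module.finrank ℝ (vectorSpan ℝ (K : Set V))

/-- A convex body contained in a subspace `E`, viewed as a convex body of `E`. -/
def bodyIn (E : Submodule ℝ V) (K : ConvexBody V) (h : (K : Set V) ⊆ (E : Set V)) :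
    ConvexBody ↥E :=
  ⟨Subtype.val ⁻¹' (K : Set V),
    K.convex.linear_preimage (E.subtype),
    by
      rw [Topology.IsEmbedding.subtypeVal.isCompact_iff,
        Set.image_preimage_eq_of_subset (by rw [Subtype.range_coe]; exact h)]
      exact K.isCompact,
    by obtain ⟨x, hx⟩ := K.nonempty; exact ⟨⟨x, h hx⟩, hx⟩⟩

/-- The properties of the components of McMullen's decomposition of (the support function
of) a Minkowski valuation: each `fᵢ(·, u)` is a continuous, translation invariant
valuation, homogeneous of degree `i`, and each `fᵢ(K, ·)` is continuous and positively
`1`-homogeneous. -/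
def McMullenProps (f : ℕ → ConvexBody V → V → ℝ) : Prop :=
  (∀ (i : ℕ) (u : V), Continuous fun K : ConvexBody V => f i K u) ∧
  (∀ (i : ℕ) (u : V), IsValuation fun K : ConvexBody V => f i K u) ∧
  (∀ (i : ℕ) (u : V), IsTranslationInvariant fun K : ConvexBody V => f i K u) ∧
  (∀ (i : ℕ) (K : ConvexBody V) (u : V) (t : ℝ), 0 < t → f i (t • K) u = t ^ i * f i K u) ∧
  (∀ (i : ℕ) (K : ConvexBody V), Continuous fun u : V => f i K u) ∧
  (∀ (i : ℕ) (K : ConvexBody V) (u : V) (t : ℝ), 0 < t → f i K (t • u) = t * f i K u)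

end CommonDefs

/-- The surface area measure `S(M, ·)` on `S¹ ⊆ ℂ` of a planar convex body `M`,
characterized (uniquely) by the property that it is a finite measure concentrated on the
unit circle with `∫_{S¹} h(L, α) dσ(α) = 2 V(M, L)` for every planar convex body `L`. -/
def IsSurfaceAreaMeasure (M : ConvexBody ℂ) (σ : Measure ℂ) : Prop :=
  IsFiniteMeasure σ ∧ σ (Metric.sphere (0 : ℂ) 1)ᶜ = 0 ∧
    ∀ L : ConvexBody ℂ,
      (∫ α, hSupp L (fun c => (c * (starRingEnd ℂ) α).re) ∂σ) = 2 * mixedVol volume ![M, L]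

section Helpers

variable {V : Type*} [NormedAddCommGroup V] [NormedSpace ℝ V]

/-- Any segment joining two closed sets whose union is convex meets their intersection. -/
lemma Convex.exists_mem_segment_inter {A B : Set V} (hA : IsClosed A) (hB : IsClosed B)
    (hAB : Convex ℝ (A ∪ B)) {a b : V} (ha : a ∈ A) (hb : b ∈ B) :
    ∃ x ∈ segment ℝ a b, x ∈ A ∩ B := by
  have hsub : segment ℝ a b ⊆ A ∪ B := hAB.segment_subset (Or.inl ha) (Or.inr hb)
  obtain ⟨x, hx, hx'⟩ := isPreconnected_closed_iff.1 (convex_segment a b).isPreconnected A B hA hB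
    hsub ⟨a, left_mem_segment ℝ a b, ha⟩ ⟨b, right_mem_segment ℝ a b, hb⟩
  exact ⟨x, hx, hx'⟩

/-- Minkowski addition distributes over the intersection of closed convex sets whose union
is convex. -/
lemma Convex.inter_add_of_convex_union {A B M : Set V} (hA : IsClosed A) (hB : IsClosed B)
    (hAB : Convex ℝ (A ∪ B)) (hM : Convex ℝ M) : A ∩ B + M = (A + M) ∩ (B + M) := by
  refine Set.Subset.antisymm Set.inter_add_subset ?_
  rintro x ⟨⟨a, ha, m, hm, rfl⟩, ⟨b, hb, m', hm', h⟩⟩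
  obtain ⟨y, ⟨c, d, hc, hd, hcd, rfl⟩, hy⟩ := hAB.exists_mem_segment_inter hA hB ha hb
  refine ⟨_, hy, c • m + d • m', hM hm hm' hc hd hcd, ?_⟩
  simp only at h ⊢
  calc c • a + d • b + (c • m + d • m') = c • (a + m) + d • (b + m') := by module
    _ = (c + d) • (a + m) := by rw [h]; module
    _ = a + m := by rw [hcd, one_smul]

lemma IsValuation.apply_eq {φ : ConvexBody V → ℝ} (hφ : IsValuation φ) {K L U I : ConvexBody V}
    (hU : (U : Set V) = (K : Set V) ∪ L) (hI : (I : Set V) = (K : Set V) ∩ L) :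
    φ U + φ I = φ K + φ L := by
  have h := hφ K L (hU ▸ U.convex) (hI ▸ I.nonempty)
  have h1 : K.union L (hU ▸ U.convex) = U := ConvexBody.ext hU.symm
  have h2 : K.inter L (hI ▸ I.nonempty) = I := ConvexBody.ext hI.symm
  rwa [h1, h2] at h

lemma ConvexBody.coe_union (K L : ConvexBody V) (h) : (K.union L h : Set V) = (K : Set V) ∪ L := rfl

lemma ConvexBody.coe_inter (K L : ConvexBody V) (h) :
    (K.inter L h : Set V) = (K : Set V) ∩ L := rfl

lemma ConvexBody.coe_translate (K : ConvexBody V) (x : V) :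
    (K.translate x : Set V) = {x} + (K : Set V) := Set.singleton_add.symm

lemma IsValuation.comp_add_right {φ : ConvexBody V → ℝ} (hφ : IsValuation φ) (M : ConvexBody V) :
    IsValuation fun K => φ (K + M) := by
  intro K L hU hI
  refine hφ.apply_eq ?_ ?_
  · simp only [ConvexBody.coe_add, ConvexBody.coe_union, Set.union_add]
  · simp only [ConvexBody.coe_add, ConvexBody.coe_inter]
    exact hU.inter_add_of_convex_union K.isClosed L.isClosed M.convex

lemma IsTranslationInvariant.comp_add_right {φ : ConvexBody V → ℝ}
    (hφ : IsTranslationInvariant φ) (M : ConvexBody V) :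
    IsTranslationInvariant fun K => φ (K + M) := by
  intro K x
  change φ (K.translate x + M) = φ (K + M)
  rw [← hφ (K + M) x]
  congr 1
  ext1
  simp only [ConvexBody.coe_translate, ConvexBody.coe_add, add_assoc]

lemma IsValuation.comp_smul {φ : ConvexBody V → ℝ} (hφ : IsValuation φ) (c : ℝ) :
    IsValuation fun K => φ (c • K) := by
  intro K L hU hI
  rcases eq_or_ne c 0 with rfl | hc
  · have h (K : ConvexBody V) : (0 : ℝ) • K = 0 :=
      ConvexBody.ext (by simp [Set.zero_smul_set K.nonempty])
    simp only [h]
  · refine hφ.apply_eq ?_ ?_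
    · simp only [ConvexBody.coe_smul, ConvexBody.coe_union, Set.smul_set_union]
    · simp only [ConvexBody.coe_smul, ConvexBody.coe_inter, Set.smul_set_inter₀ hc]

lemma IsTranslationInvariant.comp_smul {φ : ConvexBody V → ℝ}
    (hφ : IsTranslationInvariant φ) (c : ℝ) : IsTranslationInvariant fun K => φ (c • K) := by
  intro K x
  change φ (c • K.translate x) = φ (c • K)
  rw [← hφ (c • K) (c • x)]
  congr 1
  ext1
  simp only [ConvexBody.coe_translate, ConvexBody.coe_smul, smul_add, Set.smul_set_singleton]

lemma IsValuation.sum_const_mul {ι : Type*} (s : Finset ι) (a : ι → ℝ)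
    {φ : ι → ConvexBody V → ℝ} (hφ : ∀ i, IsValuation (φ i)) :
    IsValuation fun K => ∑ i ∈ s, a i * φ i K := by
  intro K L hU hI
  simp only [← Finset.sum_add_distrib, ← mul_add, hφ _ K L hU hI]

lemma IsTranslationInvariant.sum_const_mul {ι : Type*} (s : Finset ι) (a : ι → ℝ)
    {φ : ι → ConvexBody V → ℝ} (hφ : ∀ i, IsTranslationInvariant (φ i)) :
    IsTranslationInvariant fun K => ∑ i ∈ s, a i * φ i K := by
  intro K x
  simp only [hφ _ K x]

lemma ConvexBody.dist_le_of_mem {K L : ConvexBody V} {r : ℝ} (hr : 0 ≤ r)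
    (h1 : ∀ x ∈ (K : Set V), ∃ y ∈ (L : Set V), dist x y ≤ r)
    (h2 : ∀ x ∈ (L : Set V), ∃ y ∈ (K : Set V), dist x y ≤ r) : dist K L ≤ r :=
  Metric.hausdorffDist_le_of_mem_dist hr h1 h2

lemma ConvexBody.exists_dist_le (K L : ConvexBody V) {x : V} (hx : x ∈ (K : Set V)) :
    ∃ y ∈ (L : Set V), dist x y ≤ dist K L := by
  obtain ⟨y, hy, h⟩ := L.isCompact.exists_infDist_eq_dist L.nonempty x
  exact ⟨y, hy, h ▸ Metric.infDist_le_hausdorffDist_of_mem hx ConvexBody.hausdorffEDist_ne_top⟩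

lemma ConvexBody.continuous_const_smul (c : ℝ) : Continuous fun K : ConvexBody V => c • K := by
  refine (LipschitzWith.of_dist_le_mul (K := ‖c‖₊) fun K L => ?_).continuous
  have key (K L : ConvexBody V) : ∀ x ∈ ((c • K : ConvexBody V) : Set V),
      ∃ y ∈ ((c • L : ConvexBody V) : Set V), dist x y ≤ ‖c‖ * dist K L := by
    rintro _ ⟨x, hx, rfl⟩
    obtain ⟨y, hy, h⟩ := K.exists_dist_le L hx
    refine ⟨c • y, ⟨y, hy, rfl⟩, ?_⟩
    simp only [dist_smul₀]
    gcongr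
  exact ConvexBody.dist_le_of_mem (by positivity) (key K L) (dist_comm K L ▸ key L K)

lemma ConvexBody.continuous_smul_const (K : ConvexBody V) : Continuous fun c : ℝ => c • K := by
  obtain ⟨R, hR, hK⟩ := K.isBounded.exists_pos_norm_le
  refine (LipschitzWith.of_dist_le_mul (K := ⟨R, hR.le⟩) fun c d => ?_).continuous
  have key (c d : ℝ) : ∀ x ∈ ((c • K : ConvexBody V) : Set V),
      ∃ y ∈ ((d • K : ConvexBody V) : Set V), dist x y ≤ R * dist c d := by
    rintro _ ⟨x, hx, rfl⟩
    refine ⟨d • x, ⟨x, hx, rfl⟩, ?_⟩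
    simp only [dist_eq_norm, ← sub_smul, norm_smul]
    rw [mul_comm]
    gcongr
    exact hK x hx
  exact ConvexBody.dist_le_of_mem (by positivity) (key c d) (dist_comm c d ▸ key d c)

/-- A finite set of points is in general position if each of its points is singled out by an
affine function vanishing at all the others. -/
def InGeneralPosition (s : Finset V) : Prop :=
  ∀ x ∈ s, ∃ g : V →ᵃ[ℝ] ℝ, g x = 1 ∧ ∀ y ∈ s, y ≠ x → g y = 0

lemma InGeneralPosition.mono {s t : Finset V} (hs : InGeneralPosition s) (h : t ⊆ s) :
    InGeneralPosition t := by
  intro x hx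
  obtain ⟨g, hg, hg'⟩ := hs x (h hx)
  exact ⟨g, hg, fun y hy => hg' y (h hy)⟩

/-- The face of a polytope on which a nonnegative affine function vanishes is spanned by the
generators on which it vanishes. -/
lemma mem_convexHull_filter_eq_zero [DecidableEq V] {s : Finset V} {g : V →ᵃ[ℝ] ℝ}
    (hg : ∀ y ∈ s, 0 ≤ g y) {x : V} (hx : x ∈ convexHull ℝ (s : Set V)) (hgx : g x = 0) :
    x ∈ convexHull ℝ ((s.filter fun y => g y = 0 : Finset V) : Set V) := by
  obtain ⟨w, hw, hw1, rfl⟩ := Finset.mem_convexHull'.1 hx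
  have hlin (y : V) : g y = g.linear y + g 0 := congrFun g.decomp y
  have hsum : ∑ y ∈ s, w y * g y = 0 := by
    rw [← hgx, hlin (∑ y ∈ s, w y • y), map_sum, Finset.sum_congr rfl fun y _ => by rw [hlin y]]
    simp only [mul_add, Finset.sum_add_distrib, map_smul, smul_eq_mul]
    rw [← Finset.sum_mul, hw1, one_mul]
  have hzero : ∀ y ∈ s, g y ≠ 0 → w y = 0 := fun y hy h =>
    (mul_eq_zero.1 ((Finset.sum_eq_zero_iff_of_nonneg
      fun y hy => mul_nonneg (hw y hy) (hg y hy)).1 hsum y hy)).resolve_right h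
  refine Finset.mem_convexHull'.2 ⟨w, fun y hy => hw y (Finset.mem_filter.1 hy).1, ?_, ?_⟩
  · rw [← hw1]
    exact Finset.sum_filter_of_ne fun y hy h => by_contra fun h' => h (hzero y hy h')
  · exact Finset.sum_filter_of_ne fun y hy h =>
      by_contra fun h' => h (by rw [hzero y hy h', zero_smul])

lemma nonneg_of_mem_convexHull {s : Finset V} {g : V →ᵃ[ℝ] ℝ} (hg : ∀ y ∈ s, 0 ≤ g y) {x : V}
    (hx : x ∈ convexHull ℝ (s : Set V)) : 0 ≤ g x := by
  have hconv : Convex ℝ (g ⁻¹' Set.Ici 0) := (convex_Ici (𝕜 := ℝ) (0 : ℝ)).affine_preimage g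
  exact convexHull_min (fun y hy => hg y hy) hconv hx

/-- The convex hull of a nonempty finite set. -/
def hullBody (s : Finset V) (hs : s.Nonempty) : ConvexBody V :=
  ⟨convexHull ℝ s, convex_convexHull ℝ _, s.finite_toSet.isCompact_convexHull ℝ,
    (Finset.coe_nonempty.2 hs).convexHull⟩

lemma coe_hullBody (s : Finset V) (hs : s.Nonempty) :
    (hullBody s hs : Set V) = convexHull ℝ (s : Set V) := rfl

/-- The two pieces `a • F + b • K` and `a • K + b • p` dissecting the dilate `(a + b) • K`
of a pyramid `K` with base `F` and apex `p`. -/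
lemma IsValuation.apply_add_smul_pyramid {φ : ConvexBody V → ℝ} (hφ : IsValuation φ)
    [DecidableEq V] {p : V} {s : Finset V} (hs : s.Nonempty) (hp : p ∉ s)
    (hind : InGeneralPosition (insert p s)) {a b : ℝ} (ha : 0 ≤ a) (hb : 0 ≤ b) :
    φ ((a + b) • hullBody (insert p s) (s.insert_nonempty p)) +
        φ (a • hullBody s hs + b • hullBody {p} (Finset.singleton_nonempty p)) =
      φ (a • hullBody s hs + b • hullBody (insert p s) (s.insert_nonempty p)) +
        φ (a • hullBody (insert p s) (s.insert_nonempty p) +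
          b • hullBody {p} (Finset.singleton_nonempty p)) := by
  obtain ⟨g, hgp, hgs⟩ := hind p (Finset.mem_insert_self p s)
  have hgs' : ∀ y ∈ s, g y = 0 := fun y hy =>
    hgs y (Finset.mem_insert_of_mem hy) (fun h => hp (h ▸ hy))
  have hlin (y : V) : g y = g.linear y + g 0 := congrFun g.decomp y
  set K := convexHull ℝ ((insert p s : Finset V) : Set V) with hK
  set F := convexHull ℝ (s : Set V) with hF
  have hKc : Convex ℝ K := convex_convexHull ℝ _
  have hFc : Convex ℝ F := convex_convexHull ℝ _
  have hFK : F ⊆ K := convexHull_mono (by simp)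
  have hpK : p ∈ K := subset_convexHull ℝ _ (by simp)
  have hg0 : ∀ k ∈ K, 0 ≤ g k := fun k hk => nonneg_of_mem_convexHull (s := insert p s)
    (by simp +contextual [hgp, hgs']) hk
  have hg1 : ∀ k ∈ K, g k ≤ 1 := fun k hk => by
    have := nonneg_of_mem_convexHull (s := insert p s) (g := AffineMap.const ℝ V 1 - g)
      (by simp +contextual [hgp, hgs']) hk
    simpa using this
  have hgF : ∀ k ∈ F, g k = 0 := fun k hk => by
    refine le_antisymm ?_ (hg0 k (hFK hk))
    have := nonneg_of_mem_convexHull (s := s) (g := -g) (by simp +contextual [hgs']) hk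
    simpa using this
  have hbase : ∀ k ∈ K, g k = 0 → k ∈ F := fun k hk h => by
    refine convexHull_mono ?_ (mem_convexHull_filter_eq_zero (s := insert p s) (g := g)
      (by simp +contextual [hgp, hgs']) hk h)
    intro y hy
    rcases Finset.mem_filter.1 hy with ⟨hy, hy'⟩
    rcases Finset.mem_insert.1 hy with rfl | hy
    · simp [hgp] at hy'
    · exact hy
  have hapex : ∀ k ∈ K, g k = 1 → k = p := fun k hk h => by
    have := mem_convexHull_filter_eq_zero (s := insert p s) (g := AffineMap.const ℝ V 1 - g)
      (by simp +contextual [hgp, hgs']) hk (by simp [h])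
    have h2 : k ∈ convexHull ℝ ({p} : Set V) := by
      refine convexHull_mono ?_ this
      intro y hy
      rcases Finset.mem_filter.1 hy with ⟨hy, hy'⟩
      rcases Finset.mem_insert.1 hy with rfl | hy
      · rfl
      · simp [hgs' y hy] at hy'
    simpa using h2
  refine hφ.apply_eq ?_ ?_ <;>
    simp only [ConvexBody.coe_add, ConvexBody.coe_smul, coe_hullBody, ← hK, ← hF,
      Finset.coe_singleton, convexHull_singleton, Set.smul_set_singleton]
  · refine Set.Subset.antisymm ?_ (Set.union_subset ?_ ?_)
    · rintro _ ⟨k, hk, rfl⟩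
      have hk' := hk
      rw [hK, Finset.coe_insert, convexHull_insert (by simpa using hs)] at hk'
      obtain ⟨_, rfl, f, hf, c, d, hc, hd, hcd, rfl⟩ := mem_convexJoin.1 hk'
      change f ∈ F at hf
      simp only
      rcases le_total b ((a + b) * c) with h | h
      · right
        rcases ha.eq_or_lt with rfl | ha
        · have hbd : b * d = 0 := by
            have := mul_nonneg hb hd
            have : b * c + b * d = b := by rw [← mul_add, hcd, mul_one]
            linarith
          have hbc : b * c = b := by linear_combination b * hcd - hbd
          refine ⟨_, ⟨_, hpK, rfl⟩, _, rfl, ?_⟩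
          simp only [zero_smul, zero_add, smul_add, smul_smul, hbc, hbd, add_zero]
        · refine ⟨_, ⟨_, hKc hpK (hFK hf) (a := ((a + b) * c - b) / a) (b := (a + b) * d / a)
            (div_nonneg (by linarith) ha.le) (by positivity) ?_, rfl⟩, _, rfl, ?_⟩
          · field_simp
            linear_combination (a + b) * hcd
          · simp only [smul_add, smul_smul, mul_div_cancel₀ _ ha.ne']
            module
      · left
        rcases hb.eq_or_lt with rfl | hb
        · have hac : a * c = 0 := by
            have := mul_nonneg ha hc
            linarith
          have had : a * d = a := by linear_combination a * hcd - hac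
          refine ⟨_, ⟨_, hf, rfl⟩, _, ⟨_, hpK, rfl⟩, ?_⟩
          simp only [zero_smul, add_zero, smul_add, smul_smul, hac, had, zero_add]
        · refine ⟨_, ⟨_, hf, rfl⟩, _, ⟨_, hKc hpK (hFK hf) (a := (a + b) * c / b)
            (b := ((a + b) * d - a) / b) (by positivity) (div_nonneg ?_ hb.le) ?_, rfl⟩, ?_⟩
          · have : (a + b) * c + (a + b) * d = a + b := by rw [← mul_add, hcd, mul_one]
            linarith
          · field_simp
            linear_combination (a + b) * hcd
          · simp only [smul_add, smul_smul, mul_div_cancel₀ _ hb.ne']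
            module
    · rw [hKc.add_smul ha hb]
      exact Set.add_subset_add_right (Set.smul_set_mono hFK)
    · rw [hKc.add_smul ha hb]
      refine Set.add_subset_add_left ?_
      rintro _ rfl
      exact ⟨p, hpK, rfl⟩
  · refine Set.Subset.antisymm (Set.subset_inter ?_ ?_) ?_
    · refine Set.add_subset_add_left ?_
      rintro _ rfl
      exact ⟨p, hpK, rfl⟩
    · exact Set.add_subset_add_right (Set.smul_set_mono hFK)
    · rintro x ⟨⟨_, ⟨f, hf, rfl⟩, _, ⟨k, hk, rfl⟩, rfl⟩, ⟨_, ⟨k', hk', rfl⟩, _, rfl, h⟩⟩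
      simp only at h
      have h' := congrArg g.linear h
      simp only [map_add, map_smul, smul_eq_mul] at h'
      have e1 := hlin f
      have e2 := hlin k
      have e3 := hlin k'
      have e4 := hlin p
      have e5 := hg1 k hk
      have e6 := hg0 k' hk'
      have e7 := hgF f hf
      rcases hb.eq_or_lt with rfl | hb
      · exact ⟨_, ⟨f, hf, rfl⟩, _, rfl, by simp⟩
      · have hgk : g k = 1 := by
          refine le_antisymm e5 ?_
          have : a * (g k' - g f) + b * (1 - g k) = 0 := by
            rw [← hgp, e1, e2, e3, e4]; linarith
          have h3 : 0 ≤ a * (g k' - g f) := mul_nonneg ha (by linarith)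
          have h4 : b * (1 - g k) ≤ 0 := by linarith
          nlinarith
        rw [hapex k hk hgk]
        exact ⟨_, ⟨f, hf, rfl⟩, _, rfl, rfl⟩

/-- Along the dilates of a `d`-dimensional simplex, a translation invariant valuation has
vanishing differences of order `d + 1`. -/
lemma fwdDiff_iter_simplex_eq_zero [DecidableEq V] (s : Finset V) (hs : s.Nonempty)
    (hind : InGeneralPosition s) {φ : ConvexBody V → ℝ} (hφ : IsValuation φ)
    (hφt : IsTranslationInvariant φ) (t : NNReal) :
    (fwdDiff t)^[s.card] (fun u : NNReal => φ ((u : ℝ) • hullBody s hs)) = 0 := by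
  induction hs using Finset.Nonempty.cons_induction generalizing φ with
  | singleton p =>
    have h (u : NNReal) : φ ((u : ℝ) • hullBody {p} (Finset.singleton_nonempty p)) = φ 0 := by
      rw [← hφt 0 ((u : ℝ) • p)]
      congr 1
      ext1
      simp [ConvexBody.coe_translate, coe_hullBody]
    simp only [h, Finset.card_singleton, Function.iterate_one, fwdDiff_const]
    rfl
  | cons p s hp hs ih =>
    simp only [Finset.cons_eq_insert] at hind ⊢
    set K := hullBody (insert p s) (s.insert_nonempty p)
    have hs' := hind.mono (Finset.subset_insert p s)
    rw [Finset.card_insert_of_notMem hp, Function.iterate_succ_apply]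
    have key : fwdDiff t (fun u : NNReal => φ ((u : ℝ) • K)) =
        (fun u : NNReal => φ ((u : ℝ) • hullBody s hs + (t : ℝ) • K)) +
          (-1 : ℝ) • fun u : NNReal => φ ((u : ℝ) • hullBody s hs +
            (t : ℝ) • hullBody {p} (Finset.singleton_nonempty p)) := by
      funext u
      have h := hφ.apply_add_smul_pyramid hs hp hind u.coe_nonneg t.coe_nonneg
      have h2 : φ ((u : ℝ) • K + (t : ℝ) • hullBody {p} (Finset.singleton_nonempty p)) =
          φ ((u : ℝ) • K) := by
        rw [← hφt ((u : ℝ) • K) ((t : ℝ) • p)]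
        congr 1
        ext1
        simp [ConvexBody.coe_translate, coe_hullBody, add_comm]
      simp only [fwdDiff, Pi.add_apply, Pi.smul_apply, smul_eq_mul, NNReal.coe_add]
      rw [← h2]
      linarith
    rw [key, fwdDiff_iter_add, fwdDiff_iter_const_smul,
      ih hs' (hφ.comp_add_right _) (hφt.comp_add_right _),
      ih hs' (hφ.comp_add_right _) (hφt.comp_add_right _), smul_zero, add_zero]

lemma InGeneralPosition.insert_lineMap [DecidableEq V] {x y : V} {r : Finset V} (hxy : x ≠ y)
    (hx : x ∉ r) (hy : y ∉ r) (hind : InGeneralPosition (insert x (insert y r))) {θ : ℝ}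
    (h0 : 0 < θ) : InGeneralPosition (insert x (insert (AffineMap.lineMap x y θ) r)) := by
  obtain ⟨gx, hgx, hgx'⟩ := hind x (by simp)
  obtain ⟨gy, hgy, hgy'⟩ := hind y (by simp)
  have e1 : gx y = 0 := hgx' y (by simp) hxy.symm
  have e2 : gy x = 0 := hgy' x (by simp) hxy
  have e3 : ∀ k ∈ r, gx k = 0 := fun k hk => hgx' k (by simp [hk]) fun h => hx (h ▸ hk)
  have e4 : ∀ k ∈ r, gy k = 0 := fun k hk => hgy' k (by simp [hk]) fun h => hy (h ▸ hk)
  have line (g : V →ᵃ[ℝ] ℝ) : g (AffineMap.lineMap x y θ) = (1 - θ) * g x + θ * g y := by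
    rw [AffineMap.apply_lineMap, AffineMap.lineMap_apply_ring]
  intro k hk
  rcases Finset.mem_insert.1 hk with rfl | hk
  · refine ⟨gx - ((1 - θ) / θ) • gy, by simp [hgx, e2], ?_⟩
    intro z hz hzk
    rcases Finset.mem_insert.1 hz with rfl | hz
    · exact absurd rfl hzk
    rcases Finset.mem_insert.1 hz with rfl | hz
    · rw [line]
      simp only [AffineMap.coe_sub, Pi.sub_apply, AffineMap.coe_smul, Pi.smul_apply,
        smul_eq_mul, hgx, hgy, e1, e2]
      field_simp
      ring
    · simp [e3 z hz, e4 z hz]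
  rcases Finset.mem_insert.1 hk with rfl | hk
  · refine ⟨θ⁻¹ • gy, by
      rw [line]
      simp only [AffineMap.coe_smul, Pi.smul_apply, smul_eq_mul, hgy, e2]
      field_simp
      ring, ?_⟩
    intro z hz hzk
    rcases Finset.mem_insert.1 hz with rfl | hz
    · simp [e2]
    rcases Finset.mem_insert.1 hz with rfl | hz
    · exact absurd rfl hzk
    · simp [e4 z hz]
  · obtain ⟨g, hg, hg'⟩ := hind k (by simp [hk])
    have f1 : g x = 0 := hg' x (by simp) fun h => hx (h ▸ hk)
    have f2 : g y = 0 := hg' y (by simp) fun h => hy (h ▸ hk)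
    refine ⟨g, hg, ?_⟩
    intro z hz hzk
    rcases Finset.mem_insert.1 hz with rfl | hz
    · exact f1
    rcases Finset.mem_insert.1 hz with rfl | hz
    · rw [line, f1, f2]
      ring
    · exact hg' z (by simp [hz]) hzk

lemma segment_eq_union_lineMap (x y : V) {θ : ℝ} (h0 : 0 < θ) (h1 : θ < 1) :
    segment ℝ x y =
      segment ℝ x (AffineMap.lineMap x y θ) ∪ segment ℝ y (AffineMap.lineMap x y θ) := by
  have hq : AffineMap.lineMap x y θ ∈ segment ℝ x y := by
    rw [segment_eq_image_lineMap]
    exact ⟨θ, ⟨h0.le, h1.le⟩, rfl⟩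
  refine Set.Subset.antisymm ?_ (Set.union_subset ?_ ?_)
  · intro z hz
    obtain ⟨c, ⟨hc0, hc1⟩, rfl⟩ := (segment_eq_image_lineMap ℝ x y).subset hz
    rcases le_total c θ with h | h
    · left
      refine ⟨1 - c / θ, c / θ, ?_, by positivity, by ring, ?_⟩
      · rw [sub_nonneg, div_le_one h0]
        exact h
      · simp only [AffineMap.lineMap_apply_module, smul_add, smul_smul]
        rw [← add_assoc, ← add_smul]
        congr 2 <;> field_simp
        ring
    · right
      have h1' : 0 < 1 - θ := by linarith
      refine ⟨(c - θ) / (1 - θ), (1 - c) / (1 - θ), div_nonneg (by linarith) h1'.le,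
        div_nonneg (by linarith) h1'.le, by field_simp; ring, ?_⟩
      simp only [AffineMap.lineMap_apply_module, smul_add, smul_smul]
      rw [add_left_comm, ← add_smul]
      congr 2 <;> field_simp
      ring
  · exact (convex_segment x y).segment_subset (left_mem_segment ℝ x y) hq
  · exact (convex_segment x y).segment_subset (right_mem_segment ℝ x y) hq

lemma convexHull_insert_insert_eq_union (x y : V) (r : Set V) {θ : ℝ} (h0 : 0 < θ) (h1 : θ < 1) :
    convexHull ℝ (insert x (insert y r)) =
      convexHull ℝ (insert x (insert (AffineMap.lineMap x y θ) r)) ∪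
        convexHull ℝ (insert y (insert (AffineMap.lineMap x y θ) r)) := by
  rcases r.eq_empty_or_nonempty with rfl | hr
  · simp only [insert_empty_eq, convexHull_pair]
    exact segment_eq_union_lineMap x y h0 h1
  · have key (a b : V) : convexHull ℝ (insert a (insert b r)) =
        convexJoin ℝ (segment ℝ a b) (convexHull ℝ r) := by
      rw [← convexHull_pair, ← convexHull_union (Set.insert_nonempty _ _) hr, Set.insert_union,
        Set.singleton_union]
    rw [key, key, key, ← convexJoin_union_left, segment_eq_union_lineMap x y h0 h1]

lemma convexHull_inter_insert_lineMap [DecidableEq V] {x y : V} {r : Finset V} (hxy : x ≠ y)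
    (hx : x ∉ r) (hy : y ∉ r) (hind : InGeneralPosition (insert x (insert y r))) {θ : ℝ}
    (h0 : 0 < θ) (h1 : θ < 1) :
    convexHull ℝ ((insert x (insert (AffineMap.lineMap x y θ) r) : Finset V) : Set V) ∩
        convexHull ℝ ((insert y (insert (AffineMap.lineMap x y θ) r) : Finset V) : Set V) =
      convexHull ℝ ((insert (AffineMap.lineMap x y θ) r : Finset V) : Set V) := by
  refine Set.Subset.antisymm ?_ (Set.subset_inter ?_ ?_)
  · obtain ⟨gx, hgx, hgx'⟩ := hind x (by simp)
    obtain ⟨gy, hgy, hgy'⟩ := hind y (by simp)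
    have e1 : gx y = 0 := hgx' y (by simp) hxy.symm
    have e2 : gy x = 0 := hgy' x (by simp) hxy
    have e3 : ∀ k ∈ r, gx k = 0 := fun k hk => hgx' k (by simp [hk]) fun h => hx (h ▸ hk)
    have e4 : ∀ k ∈ r, gy k = 0 := fun k hk => hgy' k (by simp [hk]) fun h => hy (h ▸ hk)
    set q := AffineMap.lineMap x y θ with hq
    have line (g : V →ᵃ[ℝ] ℝ) : g q = (1 - θ) * g x + θ * g y := by
      rw [hq, AffineMap.apply_lineMap, AffineMap.lineMap_apply_ring]
    let m : V →ᵃ[ℝ] ℝ := θ • gx - (1 - θ) • gy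
    have hmq : m q = 0 := by
      simp only [m, AffineMap.coe_sub, Pi.sub_apply, AffineMap.coe_smul, Pi.smul_apply,
        smul_eq_mul, line, hgx, hgy, e1, e2]
      ring
    have hmr : ∀ k ∈ r, m k = 0 := fun k hk => by simp [m, e3 k hk, e4 k hk]
    have hmx : m x = θ := by simp [m, hgx, e2]
    have hmy : m y = -(1 - θ) := by simp [m, hgy, e1]
    have hm1 : ∀ k ∈ insert x (insert q r), 0 ≤ m k := by
      simp +contextual [hmx, hmq, hmr, h0.le]
    have hm2 : ∀ k ∈ insert y (insert q r), 0 ≤ (-m) k := by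
      simp +contextual [hmy, hmq, hmr, h1.le]
    rintro z ⟨hz1, hz2⟩
    have hz0 : m z = 0 := by
      have a1 := nonneg_of_mem_convexHull hm1 hz1
      have a2 := nonneg_of_mem_convexHull hm2 hz2
      simp only [AffineMap.coe_neg, Pi.neg_apply] at a2
      linarith
    refine convexHull_mono ?_ (mem_convexHull_filter_eq_zero hm1 hz1 hz0)
    intro k hk
    rcases Finset.mem_filter.1 hk with ⟨hk, hk'⟩
    rcases Finset.mem_insert.1 hk with rfl | hk
    · exact absurd (hmx.symm.trans hk') h0.ne'
    · exact hk
  · exact convexHull_mono (by simp)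
  · exact convexHull_mono (by simp)

/-- A valuation on the compact convex subsets of `V`, the empty one included. -/
def IsSetValuation (μ : Set V → ℝ) : Prop :=
  ∀ A B : Set V, Convex ℝ A → IsCompact A → Convex ℝ B → IsCompact B → Convex ℝ (A ∪ B) →
    μ (A ∪ B) + μ (A ∩ B) = μ A + μ B

open Classical in
/-- Extension of a function on convex bodies to all sets by zero. -/
def extendZero (φ : ConvexBody V → ℝ) (A : Set V) : ℝ :=
  if h : Convex ℝ A ∧ IsCompact A ∧ A.Nonempty then φ ⟨A, h.1, h.2.1, h.2.2⟩ else 0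

lemma extendZero_coe (φ : ConvexBody V → ℝ) (K : ConvexBody V) :
    extendZero φ (K : Set V) = φ K :=
  dif_pos ⟨K.convex, K.isCompact, K.nonempty⟩

lemma extendZero_empty (φ : ConvexBody V → ℝ) : extendZero φ ∅ = 0 :=
  dif_neg fun h => Set.not_nonempty_empty h.2.2

lemma IsValuation.isSetValuation_extendZero {φ : ConvexBody V → ℝ} (hφ : IsValuation φ) :
    IsSetValuation (extendZero φ) := by
  intro A B hA hA' hB hB' hAB
  rcases A.eq_empty_or_nonempty with rfl | hAn
  · simp [extendZero_empty, add_comm]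
  rcases B.eq_empty_or_nonempty with rfl | hBn
  · simp [extendZero_empty]
  obtain ⟨a, ha⟩ := hAn
  obtain ⟨b, hb⟩ := hBn
  obtain ⟨z, -, hz⟩ := hAB.exists_mem_segment_inter hA'.isClosed hB'.isClosed ha hb
  have h := hφ ⟨A, hA, hA', a, ha⟩ ⟨B, hB, hB', b, hb⟩ hAB ⟨z, hz⟩
  rw [← extendZero_coe φ, ← extendZero_coe φ, ← extendZero_coe φ, ← extendZero_coe φ] at h
  exact h

lemma IsSetValuation.inter_right {μ : Set V → ℝ} (hμ : IsSetValuation μ) {C : Set V}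
    (hC : Convex ℝ C) (hC' : IsClosed C) : IsSetValuation fun A => μ (A ∩ C) := by
  intro A B hA hA' hB hB' hAB
  have h := hμ (A ∩ C) (B ∩ C) (hA.inter hC) (hA'.inter_right hC') (hB.inter hC)
    (hB'.inter_right hC') (by rw [← Set.union_inter_distrib_right]; exact hAB.inter hC)
  rwa [← Set.union_inter_distrib_right, ← Set.inter_inter_distrib_right] at h

lemma AffineMap.convex_le_zero (g : V →ᵃ[ℝ] ℝ) : Convex ℝ {x | g x ≤ 0} :=
  (convex_Iic (𝕜 := ℝ) (0 : ℝ)).affine_preimage g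

lemma AffineMap.isClosed_le_zero [FiniteDimensional ℝ V] (g : V →ᵃ[ℝ] ℝ) :
    IsClosed {x | g x ≤ 0} :=
  isClosed_le g.continuous_of_finiteDimensional continuous_const

/-- A valuation vanishing on all simplices vanishes on the intersection of a simplex with a
half-space. -/
lemma IsSetValuation.inter_halfspace_eq_zero [DecidableEq V] [FiniteDimensional ℝ V]
    {μ : Set V → ℝ} (hμ : IsSetValuation μ)
    (h : ∀ s : Finset V, InGeneralPosition s → μ (convexHull ℝ (s : Set V)) = 0)
    (g : V →ᵃ[ℝ] ℝ) (s : Finset V) (hs : InGeneralPosition s) :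
    μ (convexHull ℝ (s : Set V) ∩ {x | g x ≤ 0}) = 0 := by
  induction hN : (s.filter fun z => g z ≠ 0).card using Nat.strong_induction_on generalizing s with
  | _ N ih =>
    subst hN
    by_cases hpos : ∃ x ∈ s, 0 < g x
    · by_cases hneg : ∃ y ∈ s, g y < 0
      · obtain ⟨x, hx, hgx⟩ := hpos
        obtain ⟨y, hy, hgy⟩ := hneg
        have hxy : x ≠ y := by
          rintro rfl
          exact lt_asymm hgx hgy
        set r := (s.erase x).erase y with hr
        have hsr : insert x (insert y r) = s := by
          rw [hr, Finset.insert_erase (Finset.mem_erase.2 ⟨hxy.symm, hy⟩), Finset.insert_erase hx]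
        have hxr : x ∉ r := by simp [hr]
        have hyr : y ∉ r := by simp [hr]
        set θ := g x / (g x - g y) with hθ
        have hden : 0 < g x - g y := by linarith
        have h0 : 0 < θ := div_pos hgx hden
        have h1 : θ < 1 := (div_lt_one hden).2 (by linarith)
        set q := AffineMap.lineMap x y θ with hq
        have hgq : g q = 0 := by
          rw [hq, AffineMap.apply_lineMap, AffineMap.lineMap_apply_ring, hθ]
          field_simp
          ring
        have hq' : q = AffineMap.lineMap y x (1 - θ) := by
          rw [hq, AffineMap.lineMap_apply_one_sub]
        have hs' := hs
        rw [← hsr] at hs'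
        have i1 : InGeneralPosition (insert x (insert q r)) :=
          hs'.insert_lineMap hxy hxr hyr h0
        have i2 : InGeneralPosition (insert y (insert q r)) := by
          rw [hq']
          rw [Finset.insert_comm] at hs'
          exact hs'.insert_lineMap hxy.symm hyr hxr (by linarith)
        have i3 : InGeneralPosition (insert q r) := i1.mono (Finset.subset_insert _ _)
        have hrs : ∀ z ∈ r, z ∈ s := fun z hz => by rw [← hsr]; simp [hz]
        have hlt (t : Finset V) (z : V) (hz : z ∈ s) (hgz : g z ≠ 0) (hzt : z ∉ t)
            (ht : ∀ w ∈ t, g w ≠ 0 → w ∈ s) :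
            (t.filter fun z => g z ≠ 0).card < (s.filter fun z => g z ≠ 0).card := by
          refine Finset.card_lt_card ⟨?_, fun hsub => ?_⟩
          · intro w hw
            simp only [Finset.mem_filter] at hw ⊢
            exact ⟨ht w hw.1 hw.2, hw.2⟩
          · exact hzt (Finset.mem_filter.1 (hsub (Finset.mem_filter.2 ⟨hz, hgz⟩))).1
        have hxq : x ≠ q := by rintro h; rw [← h] at hgq; linarith
        have hyq : y ≠ q := by rintro h; rw [← h] at hgq; linarith
        have j1 := ih _ (hlt (insert x (insert q r)) y hy hgy.ne (by simp [hxy.symm, hyq, hyr])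
          (by simp +contextual [hx, hgq, hrs])) _ i1 rfl
        have j2 := ih _ (hlt (insert y (insert q r)) x hx hgx.ne' (by simp [hxy, hxq, hxr])
          (by simp +contextual [hy, hgq, hrs])) _ i2 rfl
        have j3 := ih _ (hlt (insert q r) x hx hgx.ne' (by simp [hxq, hxr])
          (by simp +contextual [hgq, hrs])) _ i3 rfl
        have hunion : convexHull ℝ (s : Set V) =
            convexHull ℝ ((insert x (insert q r) : Finset V) : Set V) ∪
              convexHull ℝ ((insert y (insert q r) : Finset V) : Set V) := by
          rw [← hsr]
          simp only [Finset.coe_insert]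
          exact convexHull_insert_insert_eq_union x y _ h0 h1
        have hinter := convexHull_inter_insert_lineMap hxy hxr hyr hs' h0 h1
        have hval := (hμ.inter_right g.convex_le_zero g.isClosed_le_zero) _ _
          (convex_convexHull ℝ ((insert x (insert q r) : Finset V) : Set V))
          ((Finset.finite_toSet _).isCompact_convexHull ℝ)
          (convex_convexHull ℝ ((insert y (insert q r) : Finset V) : Set V))
          ((Finset.finite_toSet _).isCompact_convexHull ℝ)
          (by rw [← hunion]; exact convex_convexHull ℝ _)
        rw [← hunion, hinter] at hval
        linarith
      · push Not at hneg
        have : convexHull ℝ (s : Set V) ∩ {x | g x ≤ 0} =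
            convexHull ℝ ((s.filter fun y => g y = 0 : Finset V) : Set V) := by
          refine Set.Subset.antisymm ?_ (Set.subset_inter ?_ ?_)
          · rintro z ⟨hz, hz'⟩
            exact mem_convexHull_filter_eq_zero hneg hz
              (le_antisymm hz' (nonneg_of_mem_convexHull hneg hz))
          · exact convexHull_mono (Finset.coe_subset.2 (Finset.filter_subset _ _))
          · refine convexHull_min ?_ g.convex_le_zero
            intro z hz
            exact (Finset.mem_filter.1 hz).2.le
        rw [this]
        exact h _ (hs.mono (Finset.filter_subset _ _))
    · push Not at hpos
      have hsub : convexHull ℝ (s : Set V) ⊆ {x | g x ≤ 0} :=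
        convexHull_min (fun z hz => hpos z hz) g.convex_le_zero
      rw [Set.inter_eq_left.2 hsub]
      exact h s hs

lemma IsSetValuation.inter_halfspaces_eq_zero [DecidableEq V] [FiniteDimensional ℝ V]
    {μ : Set V → ℝ} (hμ : IsSetValuation μ)
    (h : ∀ s : Finset V, InGeneralPosition s → μ (convexHull ℝ (s : Set V)) = 0)
    (G : List (V →ᵃ[ℝ] ℝ)) (s : Finset V) (hs : InGeneralPosition s) :
    μ (convexHull ℝ (s : Set V) ∩ {x | ∀ g ∈ G, g x ≤ 0}) = 0 := by
  induction G generalizing μ s with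
  | nil => simpa using h s hs
  | cons g G ih =>
    have := ih (hμ.inter_right g.convex_le_zero g.isClosed_le_zero)
      (fun s hs => hμ.inter_halfspace_eq_zero h g s hs) s hs
    convert this using 2
    ext z
    simp only [Set.mem_inter_iff, Set.mem_ofPred_eq, List.mem_cons, forall_eq_or_imp]
    tauto

open Polynomial in
/-- A sequence of equidistant values with vanishing differences of order `n + 1` is polynomial. -/
lemma exists_polynomial_of_fwdDiff_iter_eq_zero {M : Type*} [AddCommMonoid M] {h : M → ℝ} {n : ℕ}
    {t : M} (ht : (fwdDiff t)^[n + 1] h = 0) :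
    ∃ p : ℝ[X], p.natDegree ≤ n ∧ ∀ k : ℕ, h (k • t) = p.eval (k : ℝ) := by
  refine ⟨∑ j ∈ Finset.range (n + 1),
    C ((fwdDiff t)^[j] h 0 / j.factorial) * descPochhammer ℝ j, ?_, fun k => ?_⟩
  · refine natDegree_sum_le_of_forall_le _ _ fun j hj => ?_
    refine (natDegree_C_mul_le _ _).trans ?_
    rw [descPochhammer_natDegree]
    exact Nat.lt_succ_iff.1 (Finset.mem_range.1 hj)
  · have hvan (j : ℕ) (hj : n + 1 ≤ j) : (fwdDiff t)^[j] h = 0 := by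
      obtain ⟨i, rfl⟩ := Nat.exists_eq_add_of_le' hj
      rw [Function.iterate_add_apply, ht]
      simpa using fwdDiff_iter_const_smul (h := t) (0 : ℝ) (0 : M → ℝ) i
    have h1 := shift_eq_sum_fwdDiff_iter t h k 0
    rw [zero_add] at h1
    have h2 (j : ℕ) : eval (k : ℝ) (C ((fwdDiff t)^[j] h 0 / j.factorial) * descPochhammer ℝ j) =
        k.choose j • (fwdDiff t)^[j] h 0 := by
      rw [eval_mul, eval_C, descPochhammer_eval_eq_descFactorial,
        Nat.descFactorial_eq_factorial_mul_choose]
      push_cast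
      have : (j.factorial : ℝ) ≠ 0 := by positivity
      field_simp
      simp [mul_comm]
    rw [h1, eval_finsetSum, Finset.sum_congr rfl fun j _ => h2 j]
    rcases le_total k n with hkn | hkn
    · refine Finset.sum_subset (Finset.range_mono (by lia)) fun j _ hj => ?_
      have hj : k < j := lt_of_not_ge fun h => hj (Finset.mem_range.2 (by lia))
      rw [Nat.choose_eq_zero_of_lt hj, zero_smul]
    · refine (Finset.sum_subset (Finset.range_mono (by lia)) fun j _ hj => ?_).symm
      rw [hvan j (by simpa using hj), Pi.zero_apply, smul_zero]

open Polynomial in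
lemma Polynomial.eq_of_eval_natCast_mul_eq {p q : ℝ[X]} {m : ℕ} (hm : m ≠ 0)
    (h : ∀ k : ℕ, p.eval ((k * m : ℕ) : ℝ) = q.eval ((k * m : ℕ) : ℝ)) : p = q := by
  refine eq_of_infinite_eval_eq p q (Set.Infinite.mono ?_
    (Set.infinite_range_of_injective (f := fun k : ℕ => ((k * m : ℕ) : ℝ)) ?_))
  · rintro _ ⟨k, rfl⟩
    exact h k
  · intro a b hab
    exact Nat.eq_of_mul_eq_mul_right (Nat.pos_of_ne_zero hm) (Nat.cast_injective hab)

open Polynomial in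
/-- Fréchet's theorem: a continuous function all of whose differences of order `n + 1` vanish is
a polynomial of degree at most `n`. -/
lemma exists_polynomial_eq_of_fwdDiff_iter_eq_zero {h : NNReal → ℝ} (hc : Continuous h) {n : ℕ}
    (hd : ∀ t : NNReal, (fwdDiff t)^[n + 1] h = 0) :
    ∃ p : ℝ[X], p.natDegree ≤ n ∧ ∀ u : NNReal, h u = p.eval (u : ℝ) := by
  choose p hp hpe using fun t : NNReal => exists_polynomial_of_fwdDiff_iter_eq_zero (hd t)
  refine ⟨p 1, hp 1, ?_⟩
  have hrat (q : NNRat) : h q = (p 1).eval ((q : NNReal) : ℝ) := by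
    have hden : (q.den : NNReal) ≠ 0 := by simp
    have hpoly : p (q.den : NNReal)⁻¹ = (p 1).comp (C (q.den : ℝ)⁻¹ * X) := by
      refine eq_of_eval_natCast_mul_eq (q.den_ne_zero) fun k => ?_
      have h1 := hpe (q.den : NNReal)⁻¹ (k * q.den)
      have h2 := hpe 1 k
      rw [← h1, eval_comp]
      have e1 : (k * q.den) • (q.den : NNReal)⁻¹ = k • (1 : NNReal) := by
        simp [nsmul_eq_mul, hden]
      have e2 : eval ((k * q.den : ℕ) : ℝ) (C (q.den : ℝ)⁻¹ * X) = k := by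
        have : (q.den : ℝ) ≠ 0 := by simp
        simp only [eval_mul, eval_C, eval_X]
        push_cast
        field_simp
      rw [e1, e2, h2]
    have h3 := hpe (q.den : NNReal)⁻¹ q.num
    rw [hpoly, eval_comp] at h3
    have e3 : q.num • (q.den : NNReal)⁻¹ = q := by
      rw [nsmul_eq_mul, ← div_eq_mul_inv, ← NNRat.cast_def]
    rw [e3] at h3
    rw [h3]
    congr 1
    simp only [eval_mul, eval_C, eval_X]
    rw [← e3, nsmul_eq_mul, NNReal.coe_mul, NNReal.coe_inv, NNReal.coe_natCast,
      NNReal.coe_natCast, mul_comm]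
  have hdense : DenseRange ((↑) : NNRat → NNReal) := by
    refine dense_of_exists_between fun a b hab => ?_
    obtain ⟨q, hq, hq'⟩ := exists_rat_btwn (NNReal.coe_lt_coe.2 hab)
    have hq0 : 0 ≤ q := by
      have h0 : (0 : ℝ) ≤ q := a.coe_nonneg.trans hq.le
      exact_mod_cast h0
    lift q to NNRat using hq0
    rw [Rat.cast_nnratCast] at hq hq'
    exact ⟨q, ⟨q, rfl⟩, NNReal.coe_lt_coe.1 hq, NNReal.coe_lt_coe.1 hq'⟩
  exact congrFun (hdense.equalizer hc ((p 1).continuous.comp NNReal.continuous_coe)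
    (funext hrat))

lemma InGeneralPosition.card_le [FiniteDimensional ℝ V] {s : Finset V} (hs : InGeneralPosition s) :
    s.card ≤ finrank ℝ V + 1 := by
  have hind : AffineIndependent ℝ ((↑) : s → V) := by
    refine affineIndependent_iff.2 fun u w hw hw' e he => ?_
    obtain ⟨g, hg, hg'⟩ := hs e e.2
    have hlin (y : V) : g y = g.linear y + g 0 := congrFun g.decomp y
    have h0 : ∑ i ∈ u, w i * g i = 0 := by
      have := congrArg g.linear hw'
      simp only [map_sum, map_smul, smul_eq_mul, map_zero] at this
      rw [Finset.sum_congr rfl fun i _ => congrArg (w i * ·) (hlin i)]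
      simp only [mul_add, Finset.sum_add_distrib, this, ← Finset.sum_mul, hw, zero_mul, add_zero]
    rw [Finset.sum_eq_single_of_mem e he, hg, mul_one] at h0
    · exact h0
    · intro i _ hi
      rw [hg' i i.2 fun h => hi (Subtype.ext h), mul_zero]
  have h := hind.card_le_finrank_succ
  rw [Fintype.card_coe] at h
  exact h.trans (Nat.add_le_add_right (Submodule.finrank_le _) 1)

/-- Every bounded set is contained in a simplex. -/
lemma exists_inGeneralPosition_subset_convexHull [DecidableEq V] [FiniteDimensional ℝ V] {A : Set V}
    (hA : Bornology.IsBounded A) :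
    ∃ s : Finset V, InGeneralPosition s ∧ A ⊆ convexHull ℝ (s : Set V) := by
  obtain ⟨b⟩ : Nonempty (AffineBasis (Fin (finrank ℝ V + 1)) ℝ V) :=
    AffineBasis.exists_affineBasis_of_finiteDimensional (by simp)
  obtain ⟨c, hc⟩ : (interior (convexHull ℝ (Set.range b))).Nonempty :=
    ⟨_, b.centroid_mem_interior_convexHull⟩
  obtain ⟨ε, hε, hball⟩ := Metric.mem_nhds_iff.1 (mem_interior_iff_mem_nhds.1 hc)
  obtain ⟨R, hR, hAR⟩ := hA.subset_ball_lt 0 c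
  have hinv1 (x : V) : AffineMap.homothety c (ε / R) (AffineMap.homothety c (R / ε) x) = x := by
    rw [← AffineMap.homothety_mul_apply, div_mul_div_cancel₀ hR.ne', div_self hε.ne',
      AffineMap.homothety_one, AffineMap.id_apply]
  have hinv2 (x : V) : AffineMap.homothety c (R / ε) (AffineMap.homothety c (ε / R) x) = x := by
    rw [← AffineMap.homothety_mul_apply, div_mul_div_cancel₀ hε.ne', div_self hR.ne',
      AffineMap.homothety_one, AffineMap.id_apply]
  refine ⟨Finset.univ.image fun i => AffineMap.homothety c (R / ε) (b i), ?_, ?_⟩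
  · intro x hx
    obtain ⟨i, -, rfl⟩ := Finset.mem_image.1 hx
    refine ⟨(b.coord i).comp (AffineMap.homothety c (ε / R)), ?_, fun y hy hyx => ?_⟩
    · simp [hinv1]
    · obtain ⟨j, -, rfl⟩ := Finset.mem_image.1 hy
      have hij : i ≠ j := fun h => hyx (by rw [h])
      simp [hinv1, hij]
  · intro x hx
    have hy : AffineMap.homothety c (ε / R) x ∈ convexHull ℝ (Set.range b) := by
      refine hball ?_
      have hx' := hAR hx
      rw [Metric.mem_ball] at hx' ⊢
      rw [dist_homothety_center, Real.norm_of_nonneg (by positivity), dist_comm]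
      calc ε / R * dist x c < ε / R * R := by gcongr
        _ = ε := div_mul_cancel₀ _ hR.ne'
    have := Set.mem_image_of_mem (AffineMap.homothety c (R / ε)) hy
    rw [hinv2, AffineMap.image_convexHull, ← Set.range_comp] at this
    simpa [Function.comp_def] using this

/-- A convex body can be cut out of a compact set, up to an error `ε`, by finitely many
half-spaces. -/
lemma ConvexBody.exists_halfspaces (K : ConvexBody V) {T : Set V} (hT : IsCompact T) {ε : ℝ}
    (hε : 0 < ε) [FiniteDimensional ℝ V] :
    ∃ G : List (V →ᵃ[ℝ] ℝ), (∀ g ∈ G, ∀ x ∈ (K : Set V), g x ≤ 0) ∧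
      ∀ x ∈ T, (∀ g ∈ G, g x ≤ 0) → ∃ y ∈ (K : Set V), dist x y ≤ ε := by
  have hsep (x : V) : ∃ g : V →ᵃ[ℝ] ℝ, x ∉ (K : Set V) → (∀ y ∈ (K : Set V), g y ≤ 0) ∧ 0 < g x := by
    by_cases hx : x ∈ (K : Set V)
    · exact ⟨0, fun h => absurd hx h⟩
    · obtain ⟨f, u, hf, hu⟩ := geometric_hahn_banach_closed_point K.convex K.isClosed hx
      refine ⟨(f : V →ₗ[ℝ] ℝ).toAffineMap - AffineMap.const ℝ V u, fun _ => ⟨fun y hy => ?_, ?_⟩⟩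
      · simpa using (hf y hy).le
      · simpa using hu
  choose g hg using hsep
  have hC : IsCompact (T \ Metric.thickening ε (K : Set V)) := hT.diff Metric.isOpen_thickening
  have hnot {x : V} (hx : x ∈ T \ Metric.thickening ε (K : Set V)) : x ∉ (K : Set V) :=
    fun h => hx.2 (Metric.self_subset_thickening hε _ h)
  obtain ⟨t, ht, hcov⟩ := hC.elim_nhds_subcover (fun x => {z | 0 < g x z}) fun x hx =>
    (isOpen_lt continuous_const (g x).continuous_of_finiteDimensional).mem_nhds (hg x (hnot hx)).2
  refine ⟨t.toList.map g, ?_, fun x hx hGx => ?_⟩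
  · intro f hf
    obtain ⟨x, hx, rfl⟩ := List.mem_map.1 hf
    exact (hg x (hnot (ht x (Finset.mem_toList.1 hx)))).1
  · by_contra! hcon
    have hxC : x ∈ T \ Metric.thickening ε (K : Set V) := by
      refine ⟨hx, fun h => ?_⟩
      obtain ⟨y, hy, hxy⟩ := Metric.mem_thickening_iff.1 h
      exact absurd hxy (hcon y hy).not_gt
    obtain ⟨z, hz, hxz⟩ := Set.mem_iUnion₂.1 (hcov hxC)
    exact absurd (hGx (g z) (List.mem_map.2 ⟨z, Finset.mem_toList.2 hz, rfl⟩)) (not_le.2 hxz)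

/-- A continuous valuation vanishing on all simplices vanishes. -/
lemma IsValuation.eq_zero_of_simplex [FiniteDimensional ℝ V] {ψ : ConvexBody V → ℝ}
    (hψ : IsValuation ψ) (hc : Continuous ψ)
    (h : ∀ (s : Finset V) (hs : s.Nonempty), InGeneralPosition s → ψ (hullBody s hs) = 0)
    (K : ConvexBody V) : ψ K = 0 := by
  classical
  have hclosed : IsClosed {L | ψ L = 0} := isClosed_eq hc continuous_const
  suffices K ∈ closure {L | ψ L = 0} by rwa [hclosed.closure_eq] at this
  refine Metric.mem_closure_iff.2 fun ε hε => ?_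
  obtain ⟨s, hs, hKs⟩ := exists_inGeneralPosition_subset_convexHull K.isBounded
  have hT : IsCompact (convexHull ℝ (s : Set V)) := s.finite_toSet.isCompact_convexHull ℝ
  obtain ⟨G, hG, hG'⟩ := K.exists_halfspaces hT (half_pos hε)
  have hsimp (s : Finset V) (hs : InGeneralPosition s) :
      extendZero ψ (convexHull ℝ (s : Set V)) = 0 := by
    rcases s.eq_empty_or_nonempty with rfl | hsn
    · simp [extendZero_empty]
    · exact (extendZero_coe ψ (hullBody s hsn)).trans (h s hsn hs)
  have h0 := hψ.isSetValuation_extendZero.inter_halfspaces_eq_zero hsimp G s hs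
  have hset : {x | ∀ g ∈ G, g x ≤ 0} = ⋂ g ∈ G, {x | g x ≤ 0} := by
    ext
    simp
  have hKP : (K : Set V) ⊆ convexHull ℝ (s : Set V) ∩ {x | ∀ g ∈ G, g x ≤ 0} :=
    fun x hx => ⟨hKs hx, fun g hg => hG g hg x hx⟩
  let P : ConvexBody V :=
    ⟨convexHull ℝ (s : Set V) ∩ {x | ∀ g ∈ G, g x ≤ 0},
      (convex_convexHull ℝ _).inter (hset ▸ convex_iInter₂ fun g _ => g.convex_le_zero),
      hT.inter_right (hset ▸ isClosed_biInter fun g _ => g.isClosed_le_zero),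
      K.nonempty.mono hKP⟩
  refine ⟨P, (extendZero_coe ψ P).symm.trans h0, ?_⟩
  refine lt_of_le_of_lt (ConvexBody.dist_le_of_mem (half_pos hε).le ?_ ?_) (half_lt_self hε)
  · exact fun x hx => ⟨x, hKP hx, by simpa using (half_pos hε).le⟩
  · exact fun x hx => hG' x hx.1 hx.2

/-- Along dilates of a convex body, a continuous translation invariant valuation on an
`n`-dimensional space has vanishing differences of order `n + 1`. -/
lemma fwdDiff_iter_smul_eq_zero [FiniteDimensional ℝ V] {φ : ConvexBody V → ℝ} (hc : Continuous φ)
    (hφt : IsTranslationInvariant φ) (hφ : IsValuation φ) (K : ConvexBody V) (t : NNReal) :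
    (fwdDiff t)^[finrank ℝ V + 1] (fun u : NNReal => φ ((u : ℝ) • K)) = 0 := by
  classical
  funext y
  have hsum (L : ConvexBody V) :=
    fwdDiff_iter_eq_sum_shift t (fun u : NNReal => φ ((u : ℝ) • L)) (finrank ℝ V + 1) y
  simp only [zsmul_eq_mul] at hsum
  rw [Pi.zero_apply, hsum K]
  refine IsValuation.eq_zero_of_simplex
    (ψ := fun L => ∑ k ∈ Finset.range (finrank ℝ V + 1 + 1),
      (((-1) ^ (finrank ℝ V + 1 - k) * ((finrank ℝ V + 1).choose k : ℤ) : ℤ) : ℝ) *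
        φ (((y + k • t : NNReal) : ℝ) • L))
    (IsValuation.sum_const_mul _ _ fun k => hφ.comp_smul ((y + k • t : NNReal) : ℝ))
    (continuous_finsetSum _ fun k _ =>
      continuous_const.mul (hc.comp (ConvexBody.continuous_const_smul _))) ?_ K
  intro s hs hind
  rw [← hsum (hullBody s hs)]
  obtain ⟨i, hi⟩ := Nat.exists_eq_add_of_le' hind.card_le
  rw [hi, Function.iterate_add_apply, fwdDiff_iter_simplex_eq_zero s hs hind hφ hφt]
  simpa using congrFun (fwdDiff_iter_const_smul (h := t) (0 : ℝ) (0 : NNReal → ℝ) i) y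

open Polynomial in
/-- The function `u ↦ φ (u • K)` is a polynomial of degree at most the dimension. -/
lemma exists_polynomial_smul [FiniteDimensional ℝ V] {φ : ConvexBody V → ℝ} (hc : Continuous φ)
    (hφt : IsTranslationInvariant φ) (hφ : IsValuation φ) (K : ConvexBody V) :
    ∃ p : ℝ[X], p.natDegree ≤ finrank ℝ V ∧ ∀ t : ℝ, 0 ≤ t → φ (t • K) = p.eval t := by
  obtain ⟨p, hp, h⟩ := exists_polynomial_eq_of_fwdDiff_iter_eq_zero
    (hc.comp (K.continuous_smul_const.comp NNReal.continuous_coe))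
    (fwdDiff_iter_smul_eq_zero hc hφt hφ K)
  exact ⟨p, hp, fun t ht => h ⟨t, ht⟩⟩

/-- The `k`-th homogeneous component of a translation invariant continuous valuation: the `k`-th
coefficient of the polynomial of degree at most `n` interpolating `j ↦ φ (j • K)`. -/
def homogeneousComponent (n : ℕ) (φ : ConvexBody V → ℝ) (k : ℕ) (K : ConvexBody V) : ℝ :=
  ∑ j ∈ Finset.range (n + 1),
    (Lagrange.basis (Finset.range (n + 1)) (fun i : ℕ => (i : ℝ)) j).coeff k * φ ((j : ℝ) • K)

open Polynomial in
lemma homogeneousComponent_eq_coeff {n : ℕ} {φ : ConvexBody V → ℝ} {K : ConvexBody V} {p : ℝ[X]}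
    (hp : p.natDegree ≤ n) (h : ∀ t : ℝ, 0 ≤ t → φ (t • K) = p.eval t) (k : ℕ) :
    homogeneousComponent n φ k K = p.coeff k := by
  have hint := Lagrange.eq_interpolate_of_eval_eq (s := Finset.range (n + 1))
    (v := fun i : ℕ => (i : ℝ)) (f := p) (fun j : ℕ => φ ((j : ℝ) • K))
    Nat.cast_injective.injOn ?_ fun j _ => (h j j.cast_nonneg).symm
  · rw [hint, Lagrange.interpolate_apply, finsetSum_coeff]
    exact Finset.sum_congr rfl fun j _ => by rw [coeff_C_mul, mul_comm]
  · rw [Finset.card_range]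
    exact degree_lt_iff_coeff_zero _ _ |>.2 fun m hm => coeff_eq_zero_of_natDegree_lt (by lia)

open Polynomial in
lemma Polynomial.eq_of_eval_nonneg_eq {p q : ℝ[X]} (h : ∀ t : ℝ, 0 ≤ t → p.eval t = q.eval t) :
    p = q :=
  eq_of_infinite_eval_eq p q ((Set.Ici_infinite (0 : ℝ)).mono h)

end Helpers

/-- McMullen's decomposition. Let `V` be an `n`-dimensional real
vector space. Every continuous, translation invariant, real-valued valuation `φ` on
`𝒦(V)` can be written uniquely as `φ = ∑_{k=0}^{n} φ_k` with each `φ_k` a continuous,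
translation invariant valuation, homogeneous of degree `k` (`φ_k(t K) = t^k φ_k(K)` for
all `t ≥ 0`). -/
theorem mcmullen_decomposition
    {V : Type*} [NormedAddCommGroup V] [NormedSpace ℝ V] [FiniteDimensional ℝ V]
    (n : ℕ) (hn : Module.finrank ℝ V = n)
    (φ : ConvexBody V → ℝ) (hφc : Continuous φ)
    (hφt : IsTranslationInvariant φ) (hφv : IsValuation φ) :
    ∃ f : ℕ → ConvexBody V → ℝ,
      (∀ k : ℕ, Continuous (f k) ∧ IsTranslationInvariant (f k) ∧ IsValuation (f k) ∧
        ∀ (K : ConvexBody V) (t : ℝ), 0 ≤ t → f k (t • K) = t ^ k * f k K) ∧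
      (∀ K : ConvexBody V, φ K = ∑ k ∈ Finset.range (n + 1), f k K) ∧
      (∀ g : ℕ → ConvexBody V → ℝ,
        ((∀ k : ℕ, Continuous (g k) ∧ IsTranslationInvariant (g k) ∧ IsValuation (g k) ∧
            ∀ (K : ConvexBody V) (t : ℝ), 0 ≤ t → g k (t • K) = t ^ k * g k K) ∧
          (∀ K : ConvexBody V, φ K = ∑ k ∈ Finset.range (n + 1), g k K)) →
        ∀ k ≤ n, g k = f k) := by
  subst hn
  choose p hp hpe using exists_polynomial_smul hφc hφt hφv
  have hcoeff (k : ℕ) (K : ConvexBody V) :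
      homogeneousComponent (finrank ℝ V) φ k K = (p K).coeff k :=
    homogeneousComponent_eq_coeff (hp K) (hpe K) k
  refine ⟨homogeneousComponent (finrank ℝ V) φ, fun k => ⟨?_, ?_, ?_, fun K t ht => ?_⟩,
    fun K => ?_, ?_⟩
  · exact continuous_finsetSum _ fun j _ =>
      continuous_const.mul (hφc.comp (ConvexBody.continuous_const_smul _))
  · exact IsTranslationInvariant.sum_const_mul _ _ fun j => hφt.comp_smul _
  · exact IsValuation.sum_const_mul _ _ fun j => hφv.comp_smul _
  · have hcomp : p (t • K) = (p K).comp (Polynomial.C t * Polynomial.X) := by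
      refine Polynomial.eq_of_eval_nonneg_eq fun u hu => ?_
      rw [← hpe _ u hu, smul_smul, hpe K _ (mul_nonneg hu ht)]
      rw [Polynomial.eval_comp, Polynomial.eval_mul, Polynomial.eval_C, Polynomial.eval_X,
        mul_comm u t]
    rw [hcoeff, hcoeff, hcomp, Polynomial.comp_C_mul_X_coeff, mul_comm]
  · have h1 := hpe K 1 zero_le_one
    rw [one_smul, Polynomial.eval_eq_sum_range' (Nat.lt_succ_iff.2 (hp K))] at h1
    simpa [hcoeff] using h1
  · rintro g ⟨hg, hsum⟩ k hk
    funext K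
    have hpoly : p K =
        ∑ i ∈ Finset.range (finrank ℝ V + 1), Polynomial.C (g i K) * Polynomial.X ^ i := by
      refine Polynomial.eq_of_eval_nonneg_eq fun t ht => ?_
      rw [← hpe K t ht, hsum, Polynomial.eval_finsetSum]
      refine Finset.sum_congr rfl fun i _ => ?_
      rw [(hg i).2.2.2 K t ht]
      rw [Polynomial.eval_mul, Polynomial.eval_C, Polynomial.eval_pow, Polynomial.eval_X, mul_comm]
    rw [hcoeff, hpoly, Polynomial.finsetSum_coeff]
    simp [Polynomial.coeff_C_mul, Polynomial.coeff_X_pow, Nat.lt_succ_iff.2 hk]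
end
end

section
/- Let V be an n-dimensional real vector space and Z : 𝒦(V) → 𝒦(V*) a continuous, translation invariant Minkowski valuation with McMullen components f_i, so that h(ZK,·) = Σ_{i=0}^{n} f_i(K,·). If a convex body K ∈ 𝒦(V) satisfies h(ZK,·) = Σ_{i=k}^{l} f_i(K,·) for some 0 ≤ k ≤ l ≤ n (i.e., f_i(K,·) = 0 for i < k and i > l), then f_k(K,·) and f_l(K,·) are support functions of convex bodies in 𝒦(V*). -/
open scoped Pointwise
open MeasureTheory Module

noncomputable section

/-- A continuous sublinear function on a finite-dimensional space is the support function of a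
convex body in the dual space. -/
theorem exists_convexBody_eq_hSupp {V : Type*} [NormedAddCommGroup V] [NormedSpace ℝ V]
    [FiniteDimensional ℝ V] (g : V → ℝ) (hg : Continuous g)
    (hsmul : ∀ t : ℝ, 0 < t → ∀ u, g (t • u) = t * g u)
    (hadd : ∀ u v, g (u + v) ≤ g u + g v) :
    ∃ B : ConvexBody (V →L[ℝ] ℝ), ∀ u : V, g u = hSupp B (fun ξ => ξ u) := by
  have g0 : g 0 = 0 := by
    have h := hsmul 2 two_pos 0
    rw [smul_zero] at h
    linarith
  let S : Set (V →L[ℝ] ℝ) := {ξ | ∀ u, ξ u ≤ g u}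
  have hattained : ∀ u, ∃ ξ ∈ S, ξ u = g u := by
    intro u
    have H : ∀ c : ℝ, c • u = 0 → c • g u = 0 := by
      intro c hc
      rcases smul_eq_zero.1 hc with rfl | rfl
      · simp
      · simp [g0]
    let p : V →ₗ.[ℝ] ℝ := LinearPMap.mkSpanSingleton' u (g u) H
    have hp : ∀ x : p.domain, p x ≤ g x := by
      rintro ⟨x, hx⟩
      obtain ⟨c, rfl⟩ := Submodule.mem_span_singleton.1 hx
      have hval : p ⟨c • u, hx⟩ = c • g u := LinearPMap.mkSpanSingleton'_apply u (g u) H c hx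
      rw [hval, smul_eq_mul]
      rcases lt_trichotomy c 0 with hc | rfl | hc
      · have h1 := hadd (c • u) ((-c) • u)
        rw [← add_smul, add_neg_cancel, zero_smul, g0, hsmul (-c) (neg_pos.2 hc)] at h1
        change c * g u ≤ g (c • u)
        linarith
      · simp [g0]
      · exact (hsmul c hc u).ge
    obtain ⟨q, hq, hqg⟩ := exists_extension_of_le_sublinear p g hsmul hadd hp
    refine ⟨LinearMap.toContinuousLinearMap q, hqg, ?_⟩
    have hu : (1 : ℝ) • u ∈ p.domain :=
      Submodule.smul_mem _ _ (Submodule.mem_span_singleton_self u)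
    have h1 := hq ⟨(1 : ℝ) • u, hu⟩
    have hval : p ⟨(1 : ℝ) • u, hu⟩ = (1 : ℝ) • g u :=
      LinearPMap.mkSpanSingleton'_apply u (g u) H 1 hu
    rw [hval] at h1
    simpa using h1
  have hclosed : IsClosed S := by
    simp only [S, Set.ofPred_forall]
    exact isClosed_iInter fun u => isClosed_le (by fun_prop) continuous_const
  have hbounded : Bornology.IsBounded S := by
    obtain ⟨M, hM⟩ := (isCompact_closedBall (0 : V) 1).exists_bound_of_continuousOn hg.continuousOn
    have hM0 : 0 ≤ M := (norm_nonneg _).trans (hM 0 (by simp))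
    have hgM : ∀ u, g u ≤ M * ‖u‖ := by
      intro u
      rcases eq_or_ne u 0 with rfl | hu
      · simp [g0]
      have hpos : 0 < ‖u‖ := norm_pos_iff.2 hu
      have h1 := hM (‖u‖⁻¹ • u) (by simp [norm_smul, hpos.ne'])
      rw [hsmul _ (inv_pos.2 hpos), Real.norm_eq_abs] at h1
      have h2 := (le_abs_self _).trans h1
      rwa [inv_mul_le_iff₀ hpos, mul_comm] at h2
    refine isBounded_iff_forall_norm_le.2 ⟨M, fun ξ hξ => ξ.opNorm_le_bound hM0 fun u => ?_⟩
    refine abs_le.2 ⟨?_, (hξ u).trans (hgM u)⟩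
    have h1 := (hξ (-u)).trans (hgM (-u))
    rw [map_neg, norm_neg] at h1
    linarith
  have hconvex : Convex ℝ S := by
    intro ξ hξ η hη a b ha hb hab u
    have h1 := mul_le_mul_of_nonneg_left (hξ u) ha
    have h2 := mul_le_mul_of_nonneg_left (hη u) hb
    have h3 : a * g u + b * g u = g u := by rw [← add_mul, hab, one_mul]
    simp only [add_apply, smul_apply, smul_eq_mul]
    linarith
  have : ProperSpace (V →L[ℝ] ℝ) := FiniteDimensional.proper ℝ _
  refine ⟨⟨S, hconvex, Metric.isCompact_of_isClosed_isBounded hclosed hbounded,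
    (hattained 0).imp fun _ h => h.1⟩, fun u => ?_⟩
  obtain ⟨ξ, hξ, hξu⟩ := hattained u
  have hgreatest : IsGreatest ((fun ξ : V →L[ℝ] ℝ => ξ u) '' S) (g u) := by
    refine ⟨⟨ξ, hξ, hξu⟩, ?_⟩
    rintro _ ⟨η, hη, rfl⟩
    exact hη u
  exact hgreatest.csSup_eq.symm

/-- The support function of a compact set of functionals is subadditive. -/
theorem hSupp_eval_add_le {V : Type*} [NormedAddCommGroup V] [NormedSpace ℝ V]
    (B : ConvexBody (V →L[ℝ] ℝ)) (u v : V) :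
    hSupp B (fun ξ => ξ (u + v)) ≤ hSupp B (fun ξ => ξ u) + hSupp B (fun ξ => ξ v) := by
  have hbdd : ∀ w : V, BddAbove ((fun ξ : V →L[ℝ] ℝ => ξ w) '' (B : Set (V →L[ℝ] ℝ))) :=
    fun w => (B.isCompact.image (by fun_prop)).bddAbove
  refine csSup_le (B.nonempty.image _) ?_
  rintro _ ⟨ξ, hξ, rfl⟩
  simp only [map_add]
  exact add_le_add (le_csSup (hbdd u) ⟨ξ, hξ, rfl⟩) (le_csSup (hbdd v) ⟨ξ, hξ, rfl⟩)

/-- If `∑ i ∈ I, s ^ e i * P i` is subadditive for every `s > 0`, then so is the constant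
coefficient of this polynomial in `s`. -/
theorem subadditive_of_sum_pow_subadditive {V : Type*} [Add V] (I : Finset ℕ) (e : ℕ → ℕ)
    (P : ℕ → V → ℝ) {j : ℕ} (hj : j ∈ I) (hej : e j = 0) (he : ∀ i ∈ I, i ≠ j → e i ≠ 0)
    (h : ∀ s : ℝ, 0 < s → ∀ u v,
      ∑ i ∈ I, s ^ e i * P i (u + v) ≤ ∑ i ∈ I, s ^ e i * P i u + ∑ i ∈ I, s ^ e i * P i v)
    (u v : V) : P j (u + v) ≤ P j u + P j v := by
  have hlim : ∀ w, Filter.Tendsto (fun s : ℝ => ∑ i ∈ I, s ^ e i * P i w)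
      (nhdsWithin 0 (Set.Ioi 0)) (nhds (P j w)) := by
    intro w
    have hc : Continuous fun s : ℝ => ∑ i ∈ I, s ^ e i * P i w := by fun_prop
    have h0 : ∑ i ∈ I, (0 : ℝ) ^ e i * P i w = P j w := by
      rw [Finset.sum_eq_single_of_mem j hj fun i hi hij => by simp [he i hi hij]]
      simp [hej]
    rw [← h0]
    exact (hc.tendsto 0).mono_left nhdsWithin_le_nhds
  refine le_of_tendsto_of_tendsto (hlim (u + v)) ((hlim u).add (hlim v)) ?_
  filter_upwards [self_mem_nhdsWithin] with s hs using h s hs u v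

/-- Schneider–Schuster. Let `V` be an `n`-dimensional real vector
space and `Z : 𝒦(V) → 𝒦(V*)` a continuous, translation invariant Minkowski valuation
with McMullen components `f i`, so that `h(Z K, ·) = ∑_{i=0}^{n} fᵢ(K, ·)`. If a convex
body `K ∈ 𝒦(V)` satisfies `h(Z K, ·) = ∑_{i=k}^{l} fᵢ(K, ·)` for some `0 ≤ k ≤ l ≤ n`
(i.e. `fᵢ(K, ·) = 0` for `i < k` and `i > l`), then `f_k(K, ·)` and `f_l(K, ·)` are
support functions of convex bodies in `𝒦(V*)`. -/
theorem extreme_components_are_support_functions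
    {V : Type*} [NormedAddCommGroup V] [NormedSpace ℝ V] [FiniteDimensional ℝ V]
    (n : ℕ) (hn : Module.finrank ℝ V = n)
    (Z : ConvexBody V → ConvexBody (V →L[ℝ] ℝ))
    (hZc : Continuous Z) (hZt : IsTranslationInvariant Z) (hZv : IsMinkowskiValuation Z)
    (f : ℕ → ConvexBody V → V → ℝ) (hf : McMullenProps f)
    (hsum : ∀ (K : ConvexBody V) (u : V),
      hSupp (Z K) (fun ξ => ξ u) = ∑ i ∈ Finset.range (n + 1), f i K u)
    (K : ConvexBody V) (k l : ℕ) (hkl : k ≤ l) (hln : l ≤ n)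
    (hvan : ∀ i ≤ n, (i < k ∨ l < i) → ∀ u : V, f i K u = 0) :
    (∃ B : ConvexBody (V →L[ℝ] ℝ), ∀ u : V, f k K u = hSupp B (fun ξ => ξ u)) ∧
    (∃ B : ConvexBody (V →L[ℝ] ℝ), ∀ u : V, f l K u = hSupp B (fun ξ => ξ u)) := by
  obtain ⟨-, -, -, hhom, hcont, hpos⟩ := hf
  have hsum_Icc : ∀ t : ℝ, 0 < t → ∀ u,
      hSupp (Z (t • K)) (fun ξ => ξ u) = ∑ i ∈ Finset.Icc k l, t ^ i * f i K u := by
    intro t ht u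
    rw [hsum, Finset.sum_congr rfl fun i _ => hhom i K u t ht]
    refine (Finset.sum_subset (fun i hi => ?_) fun i hi hi' => ?_).symm
    · rw [Finset.mem_Icc] at hi
      rw [Finset.mem_range]
      omega
    · rw [Finset.mem_range] at hi
      rw [Finset.mem_Icc] at hi'
      rw [hvan i (by omega) (by omega) u, mul_zero]
  have hsub : ∀ t : ℝ, 0 < t → ∀ u v,
      ∑ i ∈ Finset.Icc k l, t ^ i * f i K (u + v) ≤
        ∑ i ∈ Finset.Icc k l, t ^ i * f i K u + ∑ i ∈ Finset.Icc k l, t ^ i * f i K v := by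
    intro t ht u v
    simp only [← hsum_Icc t ht]
    exact hSupp_eval_add_le _ u v
  refine ⟨exists_convexBody_eq_hSupp _ (hcont k K) (fun t ht u => hpos k K u t ht) ?_,
    exists_convexBody_eq_hSupp _ (hcont l K) (fun t ht u => hpos l K u t ht) ?_⟩
  · refine subadditive_of_sum_pow_subadditive (Finset.Icc k l) (fun i => i - k)
      (fun i => f i K) (Finset.left_mem_Icc.2 hkl) (Nat.sub_self k) (fun i hi hik => ?_)
      fun s hs u v => ?_
    · rw [Finset.mem_Icc] at hi
      omega
    · have hscale : ∀ w, ∑ i ∈ Finset.Icc k l, s ^ i * f i K w =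
          s ^ k * ∑ i ∈ Finset.Icc k l, s ^ (i - k) * f i K w := by
        intro w
        rw [Finset.mul_sum]
        refine Finset.sum_congr rfl fun i hi => ?_
        rw [← mul_assoc, ← pow_add, Nat.add_sub_cancel' (Finset.mem_Icc.1 hi).1]
      have h := hsub s hs u v
      rw [hscale, hscale, hscale, ← mul_add] at h
      exact le_of_mul_le_mul_left h (pow_pos hs k)
  · refine subadditive_of_sum_pow_subadditive (Finset.Icc k l) (fun i => l - i)
      (fun i => f i K) (Finset.right_mem_Icc.2 hkl) (Nat.sub_self l) (fun i hi hil => ?_)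
      fun s hs u v => ?_
    · rw [Finset.mem_Icc] at hi
      omega
    · have hscale : ∀ w, ∑ i ∈ Finset.Icc k l, s ^ (l - i) * f i K w =
          s ^ l * ∑ i ∈ Finset.Icc k l, s⁻¹ ^ i * f i K w := by
        intro w
        rw [Finset.mul_sum]
        refine Finset.sum_congr rfl fun i hi => ?_
        rw [← mul_assoc, inv_pow, pow_sub₀ s hs.ne' (Finset.mem_Icc.1 hi).2]
      rw [hscale, hscale, hscale, ← mul_add]
      exact mul_le_mul_of_nonneg_left (hsub s⁻¹ (inv_pos.2 hs) u v) (pow_pos hs l).le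
end
end
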